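/- In W_{2k,R} (k ≥ 2), for every 1 ≤ i < k: g_i f_k = g_{2k−i} f_k, g_i⁻¹ f_k = g_{2k−i}⁻¹ f_k, f_k g_i = f_k g_{2k−i}, f_k g_i⁻¹ = f_k g_{2k−i}⁻¹, e_i f_k = e_{2k−i} f_k, and f_k e_i = f_k e_{2k−i}. -/

import Mathlib

namespace BMW

/-- Generators of the Birman–Wenzl–Murakami algebra `W_{n,R}`:
`g i`, `g i`⁻¹ and `e i` for `1 ≤ i ≤ n - 1`. -/
inductive Gen (n : ℕ) : Type where
  | g (i : ℕ) (h : 1 ≤ i ∧ i < n) : Gen n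
  | gi (i : ℕ) (h : 1 ≤ i ∧ i < n) : Gen n
  | e (i : ℕ) (h : 1 ≤ i ∧ i < n) : Gen n

variable (R : Type*) [CommRing R]

/-- The generator `g i` in the free algebra (junk value `1` if `i` is out of range). -/
noncomputable def FG (n i : ℕ) : FreeAlgebra R (Gen n) :=
  if h : 1 ≤ i ∧ i < n then FreeAlgebra.ι R (Gen.g i h) else 1

/-- The generator `g i⁻¹` in the free algebra (junk value `1` if `i` is out of range). -/
noncomputable def FGi (n i : ℕ) : FreeAlgebra R (Gen n) :=
  if h : 1 ≤ i ∧ i < n then FreeAlgebra.ι R (Gen.gi i h) else 1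

/-- The generator `e i` in the free algebra (junk value `1` if `i` is out of range). -/
noncomputable def FE (n i : ℕ) : FreeAlgebra R (Gen n) :=
  if h : 1 ≤ i ∧ i < n then FreeAlgebra.ι R (Gen.e i h) else 1

/-- The defining relations of the Birman–Wenzl–Murakami algebra `W_{n,R}`. -/
inductive Rel (lam laminv del z : R) (n : ℕ) :
    FreeAlgebra R (Gen n) → FreeAlgebra R (Gen n) → Prop where
  | inv_right (i : ℕ) (h : 1 ≤ i ∧ i < n) :
      Rel lam laminv del z n (FG R n i * FGi R n i) 1
  | inv_left (i : ℕ) (h : 1 ≤ i ∧ i < n) :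
      Rel lam laminv del z n (FGi R n i * FG R n i) 1
  | idem (i : ℕ) (h : 1 ≤ i ∧ i < n) :
      Rel lam laminv del z n (FE R n i * FE R n i) (del • FE R n i)
  | braid (i : ℕ) (h : 1 ≤ i ∧ i + 1 < n) :
      Rel lam laminv del z n (FG R n i * FG R n (i + 1) * FG R n i)
        (FG R n (i + 1) * FG R n i * FG R n (i + 1))
  | comm_gg (i j : ℕ) (h : 1 ≤ i ∧ 1 ≤ j ∧ i < n ∧ j < n ∧ (i + 2 ≤ j ∨ j + 2 ≤ i)) :
      Rel lam laminv del z n (FG R n i * FG R n j) (FG R n j * FG R n i)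
  | comm_ge (i j : ℕ) (h : 1 ≤ i ∧ 1 ≤ j ∧ i < n ∧ j < n ∧ (i + 2 ≤ j ∨ j + 2 ≤ i)) :
      Rel lam laminv del z n (FG R n i * FE R n j) (FE R n j * FG R n i)
  | comm_ee (i j : ℕ) (h : 1 ≤ i ∧ 1 ≤ j ∧ i < n ∧ j < n ∧ (i + 2 ≤ j ∨ j + 2 ≤ i)) :
      Rel lam laminv del z n (FE R n i * FE R n j) (FE R n j * FE R n i)
  | tangle_eee_up (i : ℕ) (h : 1 ≤ i ∧ i + 1 < n) :
      Rel lam laminv del z n (FE R n i * FE R n (i + 1) * FE R n i) (FE R n i)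
  | tangle_eee_down (i : ℕ) (h : 1 ≤ i ∧ i + 1 < n) :
      Rel lam laminv del z n (FE R n (i + 1) * FE R n i * FE R n (i + 1)) (FE R n (i + 1))
  | tangle_gge_up (i : ℕ) (h : 1 ≤ i ∧ i + 1 < n) :
      Rel lam laminv del z n (FG R n i * FG R n (i + 1) * FE R n i)
        (FE R n (i + 1) * FE R n i)
  | tangle_gge_down (i : ℕ) (h : 1 ≤ i ∧ i + 1 < n) :
      Rel lam laminv del z n (FG R n (i + 1) * FG R n i * FE R n (i + 1))
        (FE R n i * FE R n (i + 1))
  | tangle_egg_up (i : ℕ) (h : 1 ≤ i ∧ i + 1 < n) :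
      Rel lam laminv del z n (FE R n i * FG R n (i + 1) * FG R n i)
        (FE R n i * FE R n (i + 1))
  | tangle_egg_down (i : ℕ) (h : 1 ≤ i ∧ i + 1 < n) :
      Rel lam laminv del z n (FE R n (i + 1) * FG R n i * FG R n (i + 1))
        (FE R n (i + 1) * FE R n i)
  | skein (i : ℕ) (h : 1 ≤ i ∧ i < n) :
      Rel lam laminv del z n (FG R n i - FGi R n i) (z • (FE R n i - 1))
  | untwist_ge (i : ℕ) (h : 1 ≤ i ∧ i < n) :
      Rel lam laminv del z n (FG R n i * FE R n i) (laminv • FE R n i)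
  | untwist_eg (i : ℕ) (h : 1 ≤ i ∧ i < n) :
      Rel lam laminv del z n (FE R n i * FG R n i) (laminv • FE R n i)
  | untwist_ege_up (i : ℕ) (h : 1 ≤ i ∧ i + 1 < n) :
      Rel lam laminv del z n (FE R n i * FG R n (i + 1) * FE R n i) (lam • FE R n i)
  | untwist_ege_down (i : ℕ) (h : 1 ≤ i ∧ i + 1 < n) :
      Rel lam laminv del z n (FE R n (i + 1) * FG R n i * FE R n (i + 1))
        (lam • FE R n (i + 1))

/-- The Birman–Wenzl–Murakami algebra `W_{n,R}`, presented by generators and relations. -/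
abbrev Alg (lam laminv del z : R) (n : ℕ) : Type _ :=
  RingQuot (Rel R lam laminv del z n)

variable (lam laminv del z : R) (n : ℕ)

/-- The generator `g i` of `W_{n,R}`. -/
noncomputable def g (i : ℕ) : Alg R lam laminv del z n :=
  RingQuot.mkAlgHom R (Rel R lam laminv del z n) (FG R n i)

/-- The generator `g i⁻¹` of `W_{n,R}`. -/
noncomputable def gi (i : ℕ) : Alg R lam laminv del z n :=
  RingQuot.mkAlgHom R (Rel R lam laminv del z n) (FGi R n i)

/-- The generator `e i` of `W_{n,R}`. -/
noncomputable def e (i : ℕ) : Alg R lam laminv del z n :=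
  RingQuot.mkAlgHom R (Rel R lam laminv del z n) (FE R n i)

end BMW

namespace BMW

variable (R : Type*) [CommRing R] (lam laminv del z : R) (n : ℕ)

/-- The ascending product `g_1 g_2 ⋯ g_k`. -/
noncomputable def gasc : ℕ → Alg R lam laminv del z n
  | 0 => 1
  | k + 1 => gasc k * g R lam laminv del z n (k + 1)

/-- The descending product `g_k ⋯ g_2 g_1`. -/
noncomputable def gdesc : ℕ → Alg R lam laminv del z n
  | 0 => 1
  | k + 1 => g R lam laminv del z n (k + 1) * gdesc k

/-- The elements `f_k`: `f_1 = e_1` and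
`f_k = (g_1 ⋯ g_{2k-2}) f_{k-1} e_{2k-1} (g_{2k-2} ⋯ g_1)` for `k ≥ 2`. -/
noncomputable def fk : ℕ → Alg R lam laminv del z n
  | 0 => 1
  | 1 => e R lam laminv del z n 1
  | k + 2 =>
      gasc R lam laminv del z n (2 * k + 2) * fk (k + 1) *
        e R lam laminv del z n (2 * k + 3) * gdesc R lam laminv del z n (2 * k + 2)

/-- The product `e_1 e_3 ⋯ e_{2k-1}`. -/
noncomputable def eodd : ℕ → Alg R lam laminv del z n
  | 0 => 1
  | k + 1 => eodd k * e R lam laminv del z n (2 * k + 1)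

end BMW

namespace BMW

open MulOpposite

/-- Sequences `g`, `gi`, `e` in an algebra satisfying the relations of `W_{n,R}` that survive
reversing the multiplication. -/
structure Family {R A : Type*} [CommRing R] [Ring A] [Algebra R A] (lam z : R) (n : ℕ)
    (g gi e : ℕ → A) : Prop where
  g_mul_gi : ∀ i, 1 ≤ i → i < n → g i * gi i = 1
  gi_mul_g : ∀ i, 1 ≤ i → i < n → gi i * g i = 1
  braid : ∀ i, 1 ≤ i → i + 1 < n → g i * g (i + 1) * g i = g (i + 1) * g i * g (i + 1)
  comm_gg : ∀ i j, 1 ≤ i → i + 2 ≤ j → j < n → Commute (g i) (g j)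
  comm_ge : ∀ i j, 1 ≤ i → i + 2 ≤ j → j < n → Commute (g i) (e j)
  comm_eg : ∀ i j, 1 ≤ i → i + 2 ≤ j → j < n → Commute (e i) (g j)
  comm_ee : ∀ i j, 1 ≤ i → i + 2 ≤ j → j < n → Commute (e i) (e j)
  eee_up : ∀ i, 1 ≤ i → i + 1 < n → e i * e (i + 1) * e i = e i
  eee_down : ∀ i, 1 ≤ i → i + 1 < n → e (i + 1) * e i * e (i + 1) = e (i + 1)
  gge_up : ∀ i, 1 ≤ i → i + 1 < n → g i * g (i + 1) * e i = e (i + 1) * e i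
  gge_down : ∀ i, 1 ≤ i → i + 1 < n → g (i + 1) * g i * e (i + 1) = e i * e (i + 1)
  egg_up : ∀ i, 1 ≤ i → i + 1 < n → e i * g (i + 1) * g i = e i * e (i + 1)
  egg_down : ∀ i, 1 ≤ i → i + 1 < n → e (i + 1) * g i * g (i + 1) = e (i + 1) * e i
  gi_eq : ∀ i, 1 ≤ i → i < n → gi i = g i - z • (e i - 1)
  comm_self : ∀ i, 1 ≤ i → i < n → Commute (e i) (g i)
  gi_mul_e : ∀ i, 1 ≤ i → i < n → gi i * e i = lam • e i

section Products

variable {M : Type*} [Monoid M]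

/-- The ascending product `x_1 x_2 ⋯ x_k`. -/
def asc (x : ℕ → M) : ℕ → M
  | 0 => 1
  | k + 1 => asc x k * x (k + 1)

/-- The descending product `x_k ⋯ x_2 x_1`. -/
def desc (x : ℕ → M) : ℕ → M
  | 0 => 1
  | k + 1 => x (k + 1) * desc x k

/-- The elements built from `g` and `e` by the recursion that defines `fk`. -/
def nest (g e : ℕ → M) : ℕ → M
  | 0 => 1
  | k + 1 => asc g (2 * k) * nest g e k * e (2 * k + 1) * desc g (2 * k)

theorem commute_asc {g : ℕ → M} {y : M} {k : ℕ}
    (h : ∀ i, 1 ≤ i → i ≤ k → Commute y (g i)) : Commute y (asc g k) := by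
  induction k with
  | zero => exact Commute.one_right y
  | succ k ih =>
    exact (ih fun i h1 h2 => h i h1 (by omega)).mul_right (h (k + 1) (by omega) le_rfl)

theorem commute_desc {g : ℕ → M} {y : M} {k : ℕ}
    (h : ∀ i, 1 ≤ i → i ≤ k → Commute y (g i)) : Commute y (desc g k) := by
  induction k with
  | zero => exact Commute.one_right y
  | succ k ih =>
    exact (h (k + 1) (by omega) le_rfl).mul_right (ih fun i h1 h2 => h i h1 (by omega))

theorem commute_nest {g e : ℕ → M} {y : M} {k : ℕ}
    (hg : ∀ i, 1 ≤ i → i < 2 * k → Commute y (g i))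
    (he : ∀ i, 1 ≤ i → i < 2 * k → Commute y (e i)) : Commute y (nest g e k) := by
  induction k with
  | zero => exact Commute.one_right y
  | succ k ih =>
    have ih := ih (fun i h1 h2 => hg i h1 (by omega)) (fun i h1 h2 => he i h1 (by omega))
    exact (((commute_asc fun i h1 h2 => hg i h1 (by omega)).mul_right ih).mul_right
      (he _ (by omega) (by omega))).mul_right (commute_desc fun i h1 h2 => hg i h1 (by omega))

theorem asc_op (g : ℕ → M) (k : ℕ) : asc (fun i => op (g i)) k = op (desc g k) := by
  induction k with
  | zero => rfl
  | succ k ih => rw [asc, ih, desc, op_mul]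

theorem desc_op (g : ℕ → M) (k : ℕ) : desc (fun i => op (g i)) k = op (asc g k) := by
  induction k with
  | zero => rfl
  | succ k ih => rw [desc, ih, asc, op_mul]

end Products

/-- The relations with the `g i` that are shared by `x = g` and `x = e`. -/
structure Slides {M : Type*} [Monoid M] (n : ℕ) (g x : ℕ → M) : Prop where
  up : ∀ i, 1 ≤ i → i + 1 < n → x (i + 1) * (g i * g (i + 1)) = g i * g (i + 1) * x i
  down : ∀ i, 1 ≤ i → i + 1 < n → x i * (g (i + 1) * g i) = g (i + 1) * g i * x (i + 1)
  comm : ∀ i j, 1 ≤ i → i < n → 1 ≤ j → j < n → i + 2 ≤ j ∨ j + 2 ≤ i ∨ i = j →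
    Commute (x i) (g j)

namespace Slides

variable {M : Type*} [Monoid M] {n : ℕ} {g x : ℕ → M}

theorem commute_asc (h : Slides n g x) {i k : ℕ} (hk : k + 2 ≤ i) (hi : i < n) :
    Commute (x i) (asc g k) :=
  BMW.commute_asc fun j h1 h2 => h.comm i j (by omega) hi h1 (by omega) (by omega)

theorem mul_asc (h : Slides n g x) {i k : ℕ} (hi : 1 ≤ i) (hik : i < k) (hk : k < n) :
    x (i + 1) * asc g k = asc g k * x i := by
  induction k with
  | zero => omega
  | succ k ih =>
    rcases Nat.lt_succ_iff_lt_or_eq.mp hik with hlt | rfl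
    · rw [asc, ← mul_assoc, ih hlt (by omega), mul_assoc, mul_assoc,
        (h.comm i (k + 1) hi (by omega) (by omega) hk (by omega)).eq]
    · obtain ⟨j, rfl⟩ : ∃ j, i = j + 1 := ⟨i - 1, by omega⟩
      rw [asc, asc, mul_assoc (asc g j), ← mul_assoc (x _),
        (h.commute_asc (by omega) (by omega)).eq, mul_assoc, h.up _ hi hk, mul_assoc (asc g j)]

theorem one_mul_asc_mul_asc (h : Slides n g x)
    (hg : ∀ i j, 1 ≤ i → i + 2 ≤ j → j < n → Commute (g i) (g j)) {k : ℕ} (hk : k + 1 < n) :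
    x 1 * (asc g (k + 1) * asc g k) = asc g (k + 1) * asc g k * x (k + 1) := by
  induction k with
  | zero =>
    simpa [asc] using (h.comm 1 1 le_rfl (by omega) le_rfl (by omega) (by omega)).eq
  | succ k ih =>
    have hg : Commute (g (k + 2)) (asc g k) := BMW.commute_asc fun j h1 h2 =>
      (hg j (k + 2) h1 (by omega) hk).symm
    have hasc : asc g (k + 2) * asc g (k + 1) =
        asc g (k + 1) * asc g k * (g (k + 2) * g (k + 1)) := by
      rw [asc.eq_2 g (k + 1), mul_assoc, asc.eq_2 g k, ← mul_assoc (g (k + 2)), hg.eq]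
      simp only [mul_assoc]
    rw [hasc, ← mul_assoc, ih (by omega), mul_assoc, h.down _ (by omega) hk]
    simp only [mul_assoc]

end Slides

namespace Family

variable {R A : Type*} [CommRing R] [Ring A] [Algebra R A] {lam z : R} {n : ℕ}
  {g gi e : ℕ → A}

theorem op (h : Family lam z n g gi e) :
    Family lam z n (fun i => op (g i)) (fun i => op (gi i)) (fun i => op (e i)) where
  g_mul_gi i h1 h2 := congrArg MulOpposite.op (h.gi_mul_g i h1 h2)
  gi_mul_g i h1 h2 := congrArg MulOpposite.op (h.g_mul_gi i h1 h2)
  braid i h1 h2 := by simpa [← op_mul, mul_assoc] using h.braid i h1 h2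
  comm_gg i j h1 h2 h3 := (h.comm_gg i j h1 h2 h3).op
  comm_ge i j h1 h2 h3 := (h.comm_ge i j h1 h2 h3).op
  comm_eg i j h1 h2 h3 := (h.comm_eg i j h1 h2 h3).op
  comm_ee i j h1 h2 h3 := (h.comm_ee i j h1 h2 h3).op
  eee_up i h1 h2 := by simpa [← op_mul, mul_assoc] using h.eee_up i h1 h2
  eee_down i h1 h2 := by simpa [← op_mul, mul_assoc] using h.eee_down i h1 h2
  gge_up i h1 h2 := by simpa [← op_mul, mul_assoc] using h.egg_up i h1 h2
  gge_down i h1 h2 := by simpa [← op_mul, mul_assoc] using h.egg_down i h1 h2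
  egg_up i h1 h2 := by simpa [← op_mul, mul_assoc] using h.gge_up i h1 h2
  egg_down i h1 h2 := by simpa [← op_mul, mul_assoc] using h.gge_down i h1 h2
  gi_eq i h1 h2 := by simp [h.gi_eq i h1 h2]
  comm_self i h1 h2 := (h.comm_self i h1 h2).op
  gi_mul_e i h1 h2 := by
    have hc : Commute (gi i) (e i) := by
      rw [h.gi_eq i h1 h2]
      exact (h.comm_self i h1 h2).symm.sub_left
        (((Commute.refl _).sub_left (Commute.one_left _)).smul_left _)
    rw [← op_mul, ← hc.eq, h.gi_mul_e i h1 h2, op_smul]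

theorem slides_g (h : Family lam z n g gi e) : Slides n g g where
  up i h1 h2 := by rw [h.braid i h1 h2, mul_assoc]
  down i h1 h2 := by rw [← h.braid i h1 h2, mul_assoc]
  comm i j hi1 hi2 hj1 hj2 hij := by
    rcases hij with hij | hij | rfl
    · exact h.comm_gg i j hi1 hij hj2
    · exact (h.comm_gg j i hj1 hij hi2).symm
    · exact Commute.refl _

theorem slides_e (h : Family lam z n g gi e) : Slides n g e where
  up i h1 h2 := by rw [h.gge_up i h1 h2, ← mul_assoc, h.egg_down i h1 h2]
  down i h1 h2 := by rw [h.gge_down i h1 h2, ← mul_assoc, h.egg_up i h1 h2]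
  comm i j hi1 hi2 hj1 hj2 hij := by
    rcases hij with hij | hij | rfl
    · exact h.comm_eg i j hi1 hij hj2
    · exact (h.comm_ge j i hj1 hij hi2).symm
    · exact h.comm_self i hi1 hi2

theorem commute_e_nest (h : Family lam z n g gi e) {j k : ℕ} (hk : 2 * k < j) (hj : j < n) :
    Commute (e j) (nest g e k) :=
  commute_nest (fun i h1 h2 => (h.comm_ge i j h1 (by omega) hj).symm)
    (fun i h1 h2 => (h.comm_ee i j h1 (by omega) hj).symm)

theorem commute_gi_g (h : Family lam z n g gi e) {i j : ℕ} (hi : 1 ≤ i) (hij : i + 2 ≤ j)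
    (hj : j < n) : Commute (gi j) (g i) := by
  rw [h.gi_eq j (by omega) hj]
  exact (h.comm_gg i j hi hij hj).symm.sub_left
    (((h.comm_ge i j hi hij hj).symm.sub_left (Commute.one_left _)).smul_left _)

theorem nest_op (h : Family lam z n g gi e) {k : ℕ} (hk : 2 * k ≤ n) :
    nest (fun i => MulOpposite.op (g i)) (fun i => MulOpposite.op (e i)) k =
      MulOpposite.op (nest g e k) := by
  induction k with
  | zero => rfl
  | succ k ih =>
    rw [nest, nest, asc_op, desc_op, ih (by omega), mul_assoc (asc g _),
      ← (h.commute_e_nest (k := k) (j := 2 * k + 1) (by omega) (by omega)).eq]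
    simp only [op_mul, mul_assoc]

theorem nest_add_two (h : Family lam z n g gi e) {m : ℕ} (hm : 2 * m + 3 < n) :
    ∃ y, nest g e (m + 2) =
      asc g (2 * m + 2) * asc g (2 * m) * (e (2 * m + 1) * e (2 * m + 3)) * y := by
  refine ⟨nest g e m * desc g (2 * m) * desc g (2 * m + 2), ?_⟩
  have h1 := h.commute_e_nest (j := 2 * m + 3) (k := m + 1) (by omega) hm
  have h2 := h.commute_e_nest (j := 2 * m + 3) (k := m) (by omega) hm
  have h3 := h.commute_e_nest (j := 2 * m + 1) (k := m) (by omega) (by omega)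
  have h4 := h.slides_e.commute_asc (i := 2 * m + 3) (k := 2 * m) (by omega) hm
  have h5 := h.comm_ee (2 * m + 1) (2 * m + 3) (by omega) (by omega) hm
  calc nest g e (m + 2)
      = asc g (2 * m + 2) * (nest g e (m + 1) * e (2 * m + 3)) * desc g (2 * m + 2) := by
        rw [nest, mul_assoc (asc g _)]
        rfl
    _ = asc g (2 * m + 2) * (e (2 * m + 3) * asc g (2 * m)) * (nest g e m * e (2 * m + 1)) *
          desc g (2 * m) * desc g (2 * m + 2) := by
        rw [← h1.eq, nest]
        simp only [mul_assoc]
    _ = _ := by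
        rw [h4.eq, ← h3.eq, h5.eq]
        simp only [mul_assoc]

/-- The outermost arc of `nest g e (m + 2)` carries `x` from strand `1` to the last strand. -/
theorem one_mul_nest (h : Family lam z n g gi e) {x : ℕ → A} (hx : Slides n g x) {m : ℕ}
    (hm : 2 * m + 3 < n)
    (hxe : g (2 * m + 1) * x (2 * m + 2) * (e (2 * m + 1) * e (2 * m + 3)) =
      g (2 * m + 3) * x (2 * m + 2) * (e (2 * m + 1) * e (2 * m + 3))) :
    x 1 * nest g e (m + 2) = x (2 * m + 3) * nest g e (m + 2) := by
  obtain ⟨y, hy⟩ := h.nest_add_two hm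
  have hcomm := h.comm_ee (2 * m + 1) (2 * m + 3) (by omega) (by omega) hm
  have hw₁ : gi (2 * m + 1) * (e (2 * m + 1) * e (2 * m + 3)) =
      lam • (e (2 * m + 1) * e (2 * m + 3)) := by
    rw [← mul_assoc, h.gi_mul_e _ (by omega) (by omega), smul_mul_assoc]
  have hw₂ : gi (2 * m + 3) * (e (2 * m + 1) * e (2 * m + 3)) =
      lam • (e (2 * m + 1) * e (2 * m + 3)) := by
    rw [hcomm.eq, ← mul_assoc, h.gi_mul_e _ (by omega) (by omega), smul_mul_assoc]
  have hfirst : x 1 * (asc g (2 * m + 2) * asc g (2 * m)) =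
      asc g (2 * m + 2) * asc g (2 * m) * (g (2 * m + 1) * x (2 * m + 2) * gi (2 * m + 1)) := by
    have hs := hx.one_mul_asc_mul_asc h.comm_gg (k := 2 * m + 1) (by omega)
    have hg := h.g_mul_gi (2 * m + 1) (by omega) (by omega)
    calc x 1 * (asc g (2 * m + 2) * asc g (2 * m))
        = x 1 * (asc g (2 * m + 2) * asc g (2 * m + 1)) * gi (2 * m + 1) := by
          rw [asc.eq_2 g (2 * m)]
          simp only [mul_assoc, hg, mul_one]
      _ = _ := by
          rw [hs, asc.eq_2 g (2 * m)]
          simp only [mul_assoc]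
  have hlast : x (2 * m + 3) * asc g (2 * m + 2) =
      asc g (2 * m + 2) * (g (2 * m + 3) * x (2 * m + 2) * gi (2 * m + 3)) := by
    have hs := hx.up (2 * m + 2) (by omega) hm
    have hg := h.g_mul_gi (2 * m + 3) (by omega) hm
    have hc := hx.commute_asc (i := 2 * m + 3) (k := 2 * m + 1) (by omega) hm
    calc x (2 * m + 3) * asc g (2 * m + 2)
        = asc g (2 * m + 1) * (x (2 * m + 3) * (g (2 * m + 2) * g (2 * m + 3))) *
            gi (2 * m + 3) := by
          rw [asc, ← mul_assoc, hc.eq]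
          simp only [mul_assoc, hg, mul_one]
      _ = _ := by
          rw [hs, asc.eq_2 g (2 * m + 1)]
          simp only [mul_assoc]
  have hpass : Commute (g (2 * m + 3) * x (2 * m + 2) * gi (2 * m + 3)) (asc g (2 * m)) :=
    ((h.slides_g.commute_asc (by omega) hm).mul_left
      (hx.commute_asc (by omega) (by omega))).mul_left
      (BMW.commute_asc fun i h1 h2 => h.commute_gi_g h1 (by omega) hm)
  rw [hy, ← mul_assoc (x 1), ← mul_assoc (x (2 * m + 3))]
  congr 1
  rw [← mul_assoc (x 1), ← mul_assoc (x (2 * m + 3)), hfirst, ← mul_assoc (x (2 * m + 3)), hlast,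
    mul_assoc (asc g (2 * m + 2)) _ (asc g _),
    hpass.eq]
  simp only [mul_assoc, hw₁, hw₂, mul_smul_comm] at hxe ⊢
  rw [hxe]

theorem slide_nest (h : Family lam z n g gi e) {x : ℕ → A} (hx : Slides n g x)
    (hxe : ∀ a, 1 ≤ a → a + 2 < n →
      g a * x (a + 1) * (e a * e (a + 2)) = g (a + 2) * x (a + 1) * (e a * e (a + 2)))
    {k : ℕ} (hk : 2 * k ≤ n) {i : ℕ} (hi : 1 ≤ i) (hik : i < k) :
    x i * nest g e k = x (2 * k - i) * nest g e k := by
  induction k generalizing i with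
  | zero => omega
  | succ k ih =>
    rcases Nat.eq_or_lt_of_le hi with rfl | hi
    · obtain ⟨m, rfl⟩ : ∃ m, k = m + 1 := ⟨k - 1, by omega⟩
      exact h.one_mul_nest hx (by omega) (hxe _ (by omega) (by omega))
    · obtain ⟨j, rfl⟩ : ∃ j, i = j + 1 := ⟨i - 1, by omega⟩
      have h1 := hx.mul_asc (i := j) (k := 2 * k) (by omega) (by omega) (by omega)
      have h2 := hx.mul_asc (i := 2 * k - j) (k := 2 * k) (by omega) (by omega) (by omega)
      have h3 := ih (by omega) (i := j) (by omega) (by omega)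
      have hsub : 2 * (k + 1) - (j + 1) = 2 * k - j + 1 := by omega
      rw [hsub, nest]
      simp only [← mul_assoc]
      rw [h1, h2, mul_assoc (asc g _) (x j), mul_assoc (asc g _) (x (2 * k - j)), h3]

theorem g_mul_nest (h : Family lam z n g gi e) {k : ℕ} (hk : 2 * k ≤ n) {i : ℕ} (hi : 1 ≤ i)
    (hik : i < k) : g i * nest g e k = g (2 * k - i) * nest g e k := by
  refine h.slide_nest h.slides_g (fun a h1 h2 => ?_) hk hi hik
  rw [← mul_assoc, h.gge_up a h1 (by omega), (h.comm_ee a (a + 2) h1 le_rfl h2).eq, ← mul_assoc,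
    h.gge_down (a + 1) (by omega) h2, mul_assoc, (h.comm_ee a (a + 2) h1 le_rfl h2).eq, mul_assoc]

theorem e_mul_nest (h : Family lam z n g gi e) {k : ℕ} (hk : 2 * k ≤ n) {i : ℕ} (hi : 1 ≤ i)
    (hik : i < k) : e i * nest g e k = e (2 * k - i) * nest g e k := by
  refine h.slide_nest h.slides_e (fun a h1 h2 => ?_) hk hi hik
  have hg := h.gi_mul_g (a + 1) (by omega) (by omega)
  have hc := h.comm_ee a (a + 2) h1 le_rfl h2
  have hleft : g a * e (a + 1) * e a = gi (a + 1) * e a := by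
    rw [← one_mul (g a * e (a + 1) * e a), ← hg]
    simp only [← mul_assoc]
    rw [mul_assoc (gi _), mul_assoc (gi _), h.gge_down a h1 (by omega), mul_assoc (gi _),
      h.eee_up a h1 (by omega)]
  have hright : g (a + 2) * e (a + 1) * e (a + 2) = gi (a + 1) * e (a + 2) := by
    rw [← one_mul (g (a + 2) * e (a + 1) * e (a + 2)), ← hg]
    simp only [← mul_assoc]
    rw [mul_assoc (gi _), mul_assoc (gi _), h.gge_up (a + 1) (by omega) h2, mul_assoc (gi _),
      h.eee_down (a + 1) (by omega) h2]
  rw [← mul_assoc, hleft, hc.eq, ← mul_assoc, hright, mul_assoc, mul_assoc, hc.eq]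

theorem gi_mul_nest (h : Family lam z n g gi e) {k : ℕ} (hk : 2 * k ≤ n) {i : ℕ} (hi : 1 ≤ i)
    (hik : i < k) : gi i * nest g e k = gi (2 * k - i) * nest g e k := by
  rw [h.gi_eq i hi (by omega), h.gi_eq (2 * k - i) (by omega) (by omega)]
  simp only [sub_mul, smul_mul_assoc, h.g_mul_nest hk hi hik, h.e_mul_nest hk hi hik]

end Family

section Alg

variable {R : Type*} [CommRing R] {lam laminv del z : R} {n : ℕ}

theorem family (hlam : lam * laminv = 1) :
    Family lam z n (g R lam laminv del z n) (gi R lam laminv del z n)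
      (e R lam laminv del z n) := by
  have rel : ∀ {a b}, Rel R lam laminv del z n a b →
      RingQuot.mkAlgHom R (Rel R lam laminv del z n) a = RingQuot.mkAlgHom R _ b :=
    fun h => RingQuot.mkAlgHom_rel R h
  have comm_ge : ∀ i j, 1 ≤ i → 1 ≤ j → i < n → j < n → (i + 2 ≤ j ∨ j + 2 ≤ i) →
      Commute (g R lam laminv del z n i) (e R lam laminv del z n j) :=
    fun i j h1 h2 h3 h4 h5 => by simpa [commute_iff_eq, g, e] using rel (.comm_ge i j ⟨h1, h2, h3, h4, h5⟩)
  have gi_mul_g : ∀ i, 1 ≤ i → i < n →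
      gi R lam laminv del z n i * g R lam laminv del z n i = 1 :=
    fun i h1 h2 => by simpa [g, gi, e] using rel (.inv_left i ⟨h1, h2⟩)
  have untwist : ∀ i, 1 ≤ i → i < n →
      g R lam laminv del z n i * e R lam laminv del z n i = laminv • e R lam laminv del z n i :=
    fun i h1 h2 => by simpa [g, gi, e] using rel (.untwist_ge i ⟨h1, h2⟩)
  have untwist' : ∀ i, 1 ≤ i → i < n →
      e R lam laminv del z n i * g R lam laminv del z n i = laminv • e R lam laminv del z n i :=
    fun i h1 h2 => by simpa [g, gi, e] using rel (.untwist_eg i ⟨h1, h2⟩)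
  exact {
    g_mul_gi := fun i h1 h2 => by simpa [g, gi, e] using rel (.inv_right i ⟨h1, h2⟩)
    gi_mul_g := gi_mul_g
    braid := fun i h1 h2 => by simpa [g, gi, e] using rel (.braid i ⟨h1, h2⟩)
    comm_gg := fun i j h1 h2 h3 => by
      simpa [commute_iff_eq, g, e] using rel (.comm_gg i j ⟨h1, by omega, by omega, h3, .inl h2⟩)
    comm_ge := fun i j h1 h2 h3 => comm_ge i j h1 (by omega) (by omega) h3 (.inl h2)
    comm_eg := fun i j h1 h2 h3 => (comm_ge j i (by omega) h1 h3 (by omega) (.inr h2)).symm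
    comm_ee := fun i j h1 h2 h3 => by
      simpa [commute_iff_eq, g, e] using rel (.comm_ee i j ⟨h1, by omega, by omega, h3, .inl h2⟩)
    eee_up := fun i h1 h2 => by simpa [g, gi, e] using rel (.tangle_eee_up i ⟨h1, h2⟩)
    eee_down := fun i h1 h2 => by simpa [g, gi, e] using rel (.tangle_eee_down i ⟨h1, h2⟩)
    gge_up := fun i h1 h2 => by simpa [g, gi, e] using rel (.tangle_gge_up i ⟨h1, h2⟩)
    gge_down := fun i h1 h2 => by simpa [g, gi, e] using rel (.tangle_gge_down i ⟨h1, h2⟩)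
    egg_up := fun i h1 h2 => by simpa [g, gi, e] using rel (.tangle_egg_up i ⟨h1, h2⟩)
    egg_down := fun i h1 h2 => by simpa [g, gi, e] using rel (.tangle_egg_down i ⟨h1, h2⟩)
    gi_eq := fun i h1 h2 => by
      have hs : g R lam laminv del z n i - gi R lam laminv del z n i =
          z • (e R lam laminv del z n i - 1) := by
        simpa only [g, gi, e, map_sub, map_smul, map_one] using rel (.skein i ⟨h1, h2⟩)
      rw [← hs, sub_sub_cancel]
    comm_self := fun i h1 h2 => (untwist' i h1 h2).trans (untwist i h1 h2).symm
    gi_mul_e := fun i h1 h2 => by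
      have hs : e R lam laminv del z n i =
          lam • (g R lam laminv del z n i * e R lam laminv del z n i) := by
        rw [untwist i h1 h2, smul_smul, hlam, one_smul]
      conv_lhs => rw [hs]
      rw [mul_smul_comm, ← mul_assoc, gi_mul_g i h1 h2, one_mul] }

variable (R lam laminv del z n)

theorem gasc_eq_asc (k : ℕ) :
    gasc R lam laminv del z n k = asc (g R lam laminv del z n) k := by
  induction k with
  | zero => rfl
  | succ k ih => rw [gasc, ih, asc]

theorem gdesc_eq_desc (k : ℕ) :
    gdesc R lam laminv del z n k = desc (g R lam laminv del z n) k := by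
  induction k with
  | zero => rfl
  | succ k ih => rw [gdesc, ih, desc]

theorem fk_eq_nest (k : ℕ) :
    fk R lam laminv del z n k = nest (g R lam laminv del z n) (e R lam laminv del z n) k := by
  induction k with
  | zero => rfl
  | succ k ih =>
    cases k with
    | zero => simp [fk, nest, asc, desc]
    | succ k =>
      rw [fk, ih, gasc_eq_asc, gdesc_eq_desc, nest.eq_2 _ _ (k + 1)]
      rfl

end Alg

/-- In `W_{2k,R}` (`k ≥ 2`), for every `1 ≤ i < k`:
`g_i f_k = g_{2k-i} f_k`, `g_i⁻¹ f_k = g_{2k-i}⁻¹ f_k`, `f_k g_i = f_k g_{2k-i}`,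
`f_k g_i⁻¹ = f_k g_{2k-i}⁻¹`, `e_i f_k = e_{2k-i} f_k`, and `f_k e_i = f_k e_{2k-i}`. -/
theorem fk_transfer_relations
    (R : Type*) [CommRing R] (lam laminv del delinv z : R)
    (hlam : lam * laminv = 1) (hdel : del * delinv = 1)
    (hskein : laminv - lam = z * (del - 1)) (k : ℕ) (hk : 2 ≤ k)
    (i : ℕ) (hi1 : 1 ≤ i) (hi2 : i < k) :
    (g R lam laminv del z (2 * k) i * fk R lam laminv del z (2 * k) k =
      g R lam laminv del z (2 * k) (2 * k - i) * fk R lam laminv del z (2 * k) k) ∧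
    (gi R lam laminv del z (2 * k) i * fk R lam laminv del z (2 * k) k =
      gi R lam laminv del z (2 * k) (2 * k - i) * fk R lam laminv del z (2 * k) k) ∧
    (fk R lam laminv del z (2 * k) k * g R lam laminv del z (2 * k) i =
      fk R lam laminv del z (2 * k) k * g R lam laminv del z (2 * k) (2 * k - i)) ∧
    (fk R lam laminv del z (2 * k) k * gi R lam laminv del z (2 * k) i =
      fk R lam laminv del z (2 * k) k * gi R lam laminv del z (2 * k) (2 * k - i)) ∧
    (e R lam laminv del z (2 * k) i * fk R lam laminv del z (2 * k) k =
      e R lam laminv del z (2 * k) (2 * k - i) * fk R lam laminv del z (2 * k) k) ∧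
    (fk R lam laminv del z (2 * k) k * e R lam laminv del z (2 * k) i =
      fk R lam laminv del z (2 * k) k * e R lam laminv del z (2 * k) (2 * k - i)) := by
  have h := family (R := R) (del := del) (z := z) (n := 2 * k) hlam
  rw [fk_eq_nest]
  set f := nest (g R lam laminv del z (2 * k)) (e R lam laminv del z (2 * k)) k
  have hop := h.nest_op le_rfl
  have hright : ∀ {a b}, op a * op f = op b * op f → f * a = f * b :=
    fun hab => op_injective hab
  exact ⟨h.g_mul_nest le_rfl hi1 hi2, h.gi_mul_nest le_rfl hi1 hi2,
    hright (hop ▸ h.op.g_mul_nest le_rfl hi1 hi2),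
    hright (hop ▸ h.op.gi_mul_nest le_rfl hi1 hi2), h.e_mul_nest le_rfl hi1 hi2,
    hright (hop ▸ h.op.e_mul_nest le_rfl hi1 hi2)⟩

end BMW
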